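/- arXiv:math/0511297 — 2 statements merged into one kernel-verified Lean document; each statement's English description precedes it below -/
import Mathlib

section
/- Let Ω' ⊆ ℝ^{n'} and Ω ⊆ ℝ^n be open and let T be a basic functional in L(G_c(Ω),ℂ̃), defined by a net (T_ε) of distributions. For every u ∈ G_c(Ω'×Ω), choosing a representative (u_ε) whose supports are all contained in a fixed compact K₁×K₂ ⊆ Ω'×Ω, the net (x ↦ T_ε(u_ε(x,·)))_ε is a moderate net of smooth functions on Ω' with supports in K₁; its class is unchanged if (u_ε) is replaced by another representative of u or (T_ε) by another net defining T, so that T(u(x,·)) := [(T_ε(u_ε(x,·)))_ε] is a well-defined element of G_c(Ω'). -/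
noncomputable section

open Set MeasureTheory Topology

/-- Euclidean space `ℝ^n`. -/
abbrev Rn (n : ℕ) := EuclideanSpace ℝ (Fin n)

namespace Colombeau

/-- A net of smooth functions on the open set `Ω ⊆ E` is *moderate*:
for every compact `K ⊆ Ω` and derivative order `i` there is `N` with
`sup_{x∈K} ‖∂^i u_ε(x)‖ = O(ε^{-N})` as `ε → 0`. -/
def IsModerate {E : Type} [NormedAddCommGroup E] [NormedSpace ℝ E]
    (Ω : Set E) (u : ℝ → E → ℂ) : Prop :=
  (∀ ε ∈ Ioc (0:ℝ) 1, ContDiffOn ℝ (⊤ : ℕ∞) (u ε) Ω) ∧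
  ∀ K : Set E, IsCompact K → K ⊆ Ω → ∀ i : ℕ,
    ∃ N : ℕ, ∃ c > 0, ∃ η ∈ Ioc (0:ℝ) 1, ∀ ε ∈ Ioc (0:ℝ) η, ∀ x ∈ K,
      ‖iteratedFDeriv ℝ i (u ε) x‖ ≤ c * ε ^ (-(N:ℝ))

/-- A net of smooth functions on `Ω` is *negligible*:
for every compact `K ⊆ Ω`, derivative order `i` and every `q`,
`sup_{x∈K} ‖∂^i u_ε(x)‖ = O(ε^q)` as `ε → 0`. -/
def IsNegligible {E : Type} [NormedAddCommGroup E] [NormedSpace ℝ E]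
    (Ω : Set E) (u : ℝ → E → ℂ) : Prop :=
  (∀ ε ∈ Ioc (0:ℝ) 1, ContDiffOn ℝ (⊤ : ℕ∞) (u ε) Ω) ∧
  ∀ K : Set E, IsCompact K → K ⊆ Ω → ∀ i : ℕ, ∀ q : ℕ,
    ∃ c > 0, ∃ η ∈ Ioc (0:ℝ) 1, ∀ ε ∈ Ioc (0:ℝ) η, ∀ x ∈ K,
      ‖iteratedFDeriv ℝ i (u ε) x‖ ≤ c * ε ^ (q:ℝ)

/-- `G^∞`-moderateness: on each compact set the exponent `N` is uniform in the
derivative order. -/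
def IsGinfModerate {E : Type} [NormedAddCommGroup E] [NormedSpace ℝ E]
    (Ω : Set E) (u : ℝ → E → ℂ) : Prop :=
  (∀ ε ∈ Ioc (0:ℝ) 1, ContDiffOn ℝ (⊤ : ℕ∞) (u ε) Ω) ∧
  ∀ K : Set E, IsCompact K → K ⊆ Ω → ∃ N : ℕ, ∀ i : ℕ,
    ∃ c > 0, ∃ η ∈ Ioc (0:ℝ) 1, ∀ ε ∈ Ioc (0:ℝ) η, ∀ x ∈ K,
      ‖iteratedFDeriv ℝ i (u ε) x‖ ≤ c * ε ^ (-(N:ℝ))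

/-- The net `u` has all its supports contained in one fixed compact subset of `Ω`. -/
def HasCmpSupp {E : Type} [NormedAddCommGroup E] [NormedSpace ℝ E]
    (Ω : Set E) (u : ℝ → E → ℂ) : Prop :=
  ∃ K : Set E, IsCompact K ∧ K ⊆ Ω ∧ ∀ ε ∈ Ioc (0:ℝ) 1, tsupport (u ε) ⊆ K

/-- Moderate nets of complex numbers (representatives of elements of `ℂ̃`). -/
def CIsModerate (z : ℝ → ℂ) : Prop :=
  ∃ N : ℕ, ∃ c > 0, ∃ η ∈ Ioc (0:ℝ) 1, ∀ ε ∈ Ioc (0:ℝ) η, ‖z ε‖ ≤ c * ε ^ (-(N:ℝ))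

/-- Negligible nets of complex numbers. -/
def CIsNegligible (z : ℝ → ℂ) : Prop :=
  ∀ q : ℕ, ∃ c > 0, ∃ η ∈ Ioc (0:ℝ) 1, ∀ ε ∈ Ioc (0:ℝ) η, ‖z ε‖ ≤ c * ε ^ (q:ℝ)

/-- `S` is a distribution on `Ω`: for each compact `K ⊆ Ω` it is continuous with respect
to some seminorm `sup_{x∈K, |α|≤j} |∂^α f(x)|` on smooth functions supported in `K`. -/
def IsDistributionOn {n : ℕ} (Ω : Set (Rn n)) (S : (Rn n → ℂ) →ₗ[ℂ] ℂ) : Prop :=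
  ∀ K : Set (Rn n), IsCompact K → K ⊆ Ω →
    ∃ j : ℕ, ∃ C : ℝ, 0 ≤ C ∧ ∀ f : Rn n → ℂ, ContDiffOn ℝ (⊤ : ℕ∞) f Ω → tsupport f ⊆ K →
      ∀ B : ℝ, (∀ x ∈ K, ∀ i ≤ j, ‖iteratedFDeriv ℝ i f x‖ ≤ B) → ‖S f‖ ≤ C * B

/-- `S` is a compactly supported distribution on `Ω`. -/
def IsCptSuppDistributionOn {n : ℕ} (Ω : Set (Rn n)) (S : (Rn n → ℂ) →ₗ[ℂ] ℂ) : Prop :=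
  ∃ K : Set (Rn n), IsCompact K ∧ K ⊆ Ω ∧
    ∃ j : ℕ, ∃ C : ℝ, 0 ≤ C ∧ ∀ f : Rn n → ℂ, ContDiffOn ℝ (⊤ : ℕ∞) f Ω →
      ∀ B : ℝ, (∀ x ∈ K, ∀ i ≤ j, ‖iteratedFDeriv ℝ i f x‖ ≤ B) → ‖S f‖ ≤ C * B

/-- A net of distributions on `Ω` defining a *basic* functional on `G_c(Ω)`:
for every compact `K ⊆ Ω` there are `j`, `N`, `η ∈ (0,1]` with
`|T_ε(f)| ≤ ε^{-N} sup_{x∈K,|α|≤j} |∂^α f(x)|` for all smooth `f` supported in `K`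
and all `ε ≤ η`. -/
def IsBasicNetC {n : ℕ} (Ω : Set (Rn n)) (T : ℝ → (Rn n → ℂ) →ₗ[ℂ] ℂ) : Prop :=
  (∀ ε ∈ Ioc (0:ℝ) 1, IsDistributionOn Ω (T ε)) ∧
  ∀ K : Set (Rn n), IsCompact K → K ⊆ Ω →
    ∃ j N : ℕ, ∃ η ∈ Ioc (0:ℝ) 1, ∀ ε ∈ Ioc (0:ℝ) η,
      ∀ f : Rn n → ℂ, ContDiffOn ℝ (⊤ : ℕ∞) f Ω → tsupport f ⊆ K →
        ∀ C : ℝ, 0 ≤ C → (∀ x ∈ K, ∀ i ≤ j, ‖iteratedFDeriv ℝ i f x‖ ≤ C) →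
          ‖T ε f‖ ≤ ε ^ (-(N:ℝ)) * C

/-- A net of compactly supported distributions on `Ω` defining a *basic* functional on
`G(Ω)`: there are a compact `K ⊆ Ω` and `j`, `N`, `η ∈ (0,1]` with
`|T_ε(f)| ≤ ε^{-N} sup_{x∈K,|α|≤j} |∂^α f(x)|` for all `f ∈ C^∞(Ω)` and all `ε ≤ η`. -/
def IsBasicNetE {n : ℕ} (Ω : Set (Rn n)) (T : ℝ → (Rn n → ℂ) →ₗ[ℂ] ℂ) : Prop :=
  (∀ ε ∈ Ioc (0:ℝ) 1, IsCptSuppDistributionOn Ω (T ε)) ∧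
  ∃ K : Set (Rn n), IsCompact K ∧ K ⊆ Ω ∧
    ∃ j N : ℕ, ∃ η ∈ Ioc (0:ℝ) 1, ∀ ε ∈ Ioc (0:ℝ) η,
      ∀ f : Rn n → ℂ, ContDiffOn ℝ (⊤ : ℕ∞) f Ω →
        ∀ C : ℝ, 0 ≤ C → (∀ x ∈ K, ∀ i ≤ j, ‖iteratedFDeriv ℝ i f x‖ ≤ C) →
          ‖T ε f‖ ≤ ε ^ (-(N:ℝ)) * C

end Colombeau

open Colombeau
namespace Colombeau

lemma tsupport_prodMk_right_subset {E F G : Type} [TopologicalSpace E] [TopologicalSpace F] [Zero G] {g : E × F → G}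
    {K₁ : Set E} {K₂ : Set F}
    (hK₂ : IsClosed K₂) (hg : tsupport g ⊆ K₁ ×ˢ K₂) (x : E) :
    tsupport (fun y => g (x, y)) ⊆ K₂ :=
  closure_minimal (fun y hy => (hg (subset_tsupport g (show g (x, y) ≠ 0 from hy))).2) hK₂

section Calculus

variable {E F G : Type} [NormedAddCommGroup E] [NormedSpace ℝ E]
  [NormedAddCommGroup F] [NormedSpace ℝ F] [NormedAddCommGroup G] [NormedSpace ℝ G]

lemma contDiff_of_tsupport_subset {f : E → G} {U : Set E} (hU : IsOpen U)
    (hf : ContDiffOn ℝ (⊤ : ℕ∞) f U) (hs : tsupport f ⊆ U) : ContDiff ℝ (⊤ : ℕ∞) f := by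
  rw [contDiff_iff_contDiffAt]
  intro x
  by_cases hx : x ∈ tsupport f
  · exact hf.contDiffAt (hU.mem_nhds (hs hx))
  · exact contDiffAt_const.congr_of_eventuallyEq (notMem_tsupport_iff_eventuallyEq.mp hx)

lemma ContDiff.prodMk_right {g : E × F → G} (hg : ContDiff ℝ (⊤ : ℕ∞) g) (x : E) :
    ContDiff ℝ (⊤ : ℕ∞) (fun y => g (x, y)) :=
  hg.comp (contDiff_const.prodMk contDiff_id)

lemma norm_iteratedFDeriv_prodMk_right_le {g : E × F → G} (hg : ContDiff ℝ (⊤ : ℕ∞) g)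
    (k : ℕ) (x : E) (y : F) :
    ‖iteratedFDeriv ℝ k (fun y => g (x, y)) y‖ ≤ ‖iteratedFDeriv ℝ k g (x, y)‖ := by
  have h1 : (fun y => g (x, y)) =
      (fun q => g ((x, 0) + q)) ∘ (ContinuousLinearMap.inr ℝ E F) := by
    ext y; simp
  have h2 : ContDiff ℝ (⊤ : ℕ∞) (fun q => g ((x, 0) + q)) :=
    hg.comp (contDiff_const.add contDiff_id)
  rw [h1, ContinuousLinearMap.iteratedFDeriv_comp_right _ h2 y
    (by exact_mod_cast (le_top : (k : ℕ∞) ≤ ⊤)), iteratedFDeriv_comp_add_left]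
  refine (ContinuousMultilinearMap.norm_compContinuousLinearMap_le _ _).trans ?_
  have h3 : ((x, 0) : E × F) + ContinuousLinearMap.inr ℝ E F y = (x, y) := by simp
  rw [h3]
  refine mul_le_of_le_one_right (norm_nonneg _) ?_
  exact Finset.prod_le_one (fun _ _ => norm_nonneg _)
    (fun _ _ => ContinuousLinearMap.norm_inr_le_one ℝ E F)

lemma ContDiff.fderiv_apply_const {g : E → G} (hg : ContDiff ℝ (⊤ : ℕ∞) g) (v : E) :
    ContDiff ℝ (⊤ : ℕ∞) (fun p => fderiv ℝ g p v) :=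
  (hg.fderiv_right (m := (⊤ : ℕ∞)) (by simp)).clm_apply contDiff_const

lemma norm_iteratedFDeriv_fderiv_apply_le {g : E → G} (hg : ContDiff ℝ (⊤ : ℕ∞) g)
    (v : E) (k : ℕ) (p : E) :
    ‖iteratedFDeriv ℝ k (fun p => fderiv ℝ g p v) p‖
      ≤ ‖v‖ * ‖iteratedFDeriv ℝ (k + 1) g p‖ := by
  rw [← norm_iteratedFDeriv_fderiv]
  exact norm_iteratedFDeriv_clm_apply_const
    (hg.fderiv_right (m := (⊤ : ℕ∞)) (by simp)).contDiffAt
    (by exact_mod_cast (le_top : (k : ℕ∞) ≤ ⊤))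

/-- The derivatives of a first order Taylor remainder are quadratically small. -/
lemma norm_iteratedFDeriv_taylor_remainder_le (k : ℕ) : ∀ {G : Type} [NormedAddCommGroup G]
    [NormedSpace ℝ G] {g : E → G}, ContDiff ℝ (⊤ : ℕ∞) g → ∀ {M : ℝ},
    (∀ p, ‖iteratedFDeriv ℝ (k + 2) g p‖ ≤ M) → ∀ v p : E,
    ‖iteratedFDeriv ℝ k (fun p => g (p + v) - g p - fderiv ℝ g p v) p‖ ≤ M * ‖v‖ * ‖v‖ := by
  induction k with
  | zero =>
    intro G _ _ g hg M hM v p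
    have hd : ContDiff ℝ (⊤ : ℕ∞) (fderiv ℝ g) := hg.fderiv_right (by simp)
    have hM' : ∀ p, ‖fderiv ℝ (fderiv ℝ g) p‖ ≤ M := fun p => by
      have := hM p
      rw [← norm_iteratedFDeriv_fderiv, ← norm_iteratedFDeriv_fderiv,
        norm_iteratedFDeriv_zero] at this
      exact this
    have hM0 : 0 ≤ M := (norm_nonneg _).trans (hM p)
    rw [norm_iteratedFDeriv_zero]
    have key := Convex.norm_image_sub_le_of_norm_fderiv_le' (𝕜 := ℝ) (f := g)
      (φ := fderiv ℝ g p) (C := M * ‖v‖) (s := Metric.closedBall p ‖v‖) (x := p) (y := p + v)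
      (fun x _ => hg.differentiable (by simp) x)
      (fun x hx => by
        refine (Convex.norm_image_sub_le_of_norm_fderiv_le (𝕜 := ℝ) (f := fderiv ℝ g) (C := M)
          (s := univ) (fun x _ => hd.differentiable (by simp) x) (fun x _ => hM' x)
          convex_univ (mem_univ p) (mem_univ x)).trans ?_
        rw [Metric.mem_closedBall, dist_eq_norm] at hx
        gcongr)
      (convex_closedBall _ _) (by simp) (by simp)
    simpa using key
  | succ k ih =>
    intro G _ _ g hg M hM v p
    have hd : ContDiff ℝ (⊤ : ℕ∞) (fderiv ℝ g) := hg.fderiv_right (by simp)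
    rw [← norm_iteratedFDeriv_fderiv]
    have h1 : fderiv ℝ (fun p => g (p + v) - g p - fderiv ℝ g p v) =
        fun p => fderiv ℝ g (p + v) - fderiv ℝ g p - fderiv ℝ (fderiv ℝ g) p v := by
      ext p w
      have hg1 : Differentiable ℝ g := hg.differentiable (by simp)
      have hg2 : Differentiable ℝ (fderiv ℝ g) := hd.differentiable (by simp)
      have e1 : DifferentiableAt ℝ (fun p => g (p + v)) p :=
        (hg1 (p + v)).comp p (differentiableAt_id.add_const v)
      have e2 : DifferentiableAt ℝ (fun p => fderiv ℝ g p v) p :=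
        (hg2 p).clm_apply (differentiableAt_const v)
      have e3 : fderiv ℝ (fun p => fderiv ℝ g p v) p w = fderiv ℝ (fderiv ℝ g) p v w := by
        rw [fderiv_clm_apply (hg2 p) (differentiableAt_const v)]
        have hsymm : IsSymmSndFDerivAt ℝ g p :=
          hg.contDiffAt.isSymmSndFDerivAt (by simpa using ENat.LEInfty.out)
        simpa using hsymm w v
      rw [fderiv_fun_sub (e1.fun_sub (hg1 p)) e2, fderiv_fun_sub e1 (hg1 p), fderiv_comp_add_right]
      simp [e3]
    rw [h1]
    refine ih hd (fun p => ?_) v p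
    rw [norm_iteratedFDeriv_fderiv]
    exact hM p

end Calculus

/-- `S` is controlled, on smooth functions supported in `K`, by `C` times the `j`-th seminorm. -/
def IsBoundedOn {n : ℕ} (S : (Rn n → ℂ) →ₗ[ℂ] ℂ) (K : Set (Rn n)) (j : ℕ) (C : ℝ) : Prop :=
  ∀ f : Rn n → ℂ, ContDiff ℝ (⊤ : ℕ∞) f → tsupport f ⊆ K →
    ∀ B : ℝ, 0 ≤ B → (∀ x ∈ K, ∀ i ≤ j, ‖iteratedFDeriv ℝ i f x‖ ≤ B) → ‖S f‖ ≤ C * B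

section Slices

variable {n' n : ℕ} {S : (Rn n → ℂ) →ₗ[ℂ] ℂ} {K₁ : Set (Rn n')} {K₂ : Set (Rn n)}
  {j : ℕ} {C : ℝ} {g : Rn n' × Rn n → ℂ}

lemma tsupport_slice_pairing_subset (hK₁ : IsClosed K₁) (hs : tsupport g ⊆ K₁ ×ˢ K₂) :
    tsupport (fun x => S (fun y => g (x, y))) ⊆ K₁ := by
  refine closure_minimal (fun x hx => ?_) hK₁
  by_contra hx1
  apply hx
  have : (fun y => g (x, y)) = 0 := by
    ext y
    exact image_eq_zero_of_notMem_tsupport (fun h => hx1 (hs h).1)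
  simp only [this, map_zero]

lemma hasFDerivAt_slice_pairing (hS : IsBoundedOn S K₂ j C)
    (hK₁ : IsCompact K₁) (hK₂ : IsCompact K₂)
    (hg : ContDiff ℝ (⊤ : ℕ∞) g) (hs : tsupport g ⊆ K₁ ×ˢ K₂) (x : Rn n') :
    ∃ L : Rn n' →L[ℝ] ℂ, HasFDerivAt (fun x => S (fun y => g (x, y))) L x ∧
      ∀ h, L h = S (fun y => fderiv ℝ g (x, y) (h, 0)) := by
  let L₀ : Rn n' →ₗ[ℝ] ℂ :=
    { toFun := fun h => S (fun y => fderiv ℝ g (x, y) (h, 0))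
      map_add' := fun h h' => by
        rw [← map_add]
        congr 1
        ext y
        rw [Pi.add_apply, ← map_add, Prod.mk_add_mk, add_zero]
      map_smul' := fun r h => by
        have : (fun y => fderiv ℝ g (x, y) (r • h, 0)) =
            (r : ℂ) • (fun y => fderiv ℝ g (x, y) (h, 0)) := by
          ext y
          have : ((r • h, 0) : Rn n' × Rn n) = r • (h, 0) := by simp
          rw [this, map_smul]
          simp
        rw [this, map_smul]
        simp }
  refine ⟨LinearMap.toContinuousLinearMap L₀, ?_, fun h => rfl⟩
  have hcs : HasCompactSupport g :=
    (hK₁.prod hK₂).of_isClosed_subset (isClosed_tsupport g) hs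
  have hbd : ∀ k : ℕ, ∃ M, ∀ p, ‖iteratedFDeriv ℝ k g p‖ ≤ M := fun k =>
    (hcs.iteratedFDeriv k).exists_bound_of_continuous
      (hg.continuous_iteratedFDeriv (by exact_mod_cast (le_top : (k : ℕ∞) ≤ ⊤)))
  choose M hM using hbd
  have hM0 : ∀ k, 0 ≤ M k := fun k => (norm_nonneg _).trans (hM k 0)
  set B := ∑ k ∈ Finset.range (j + 1), M (k + 2) with hB
  have hB0 : 0 ≤ B := Finset.sum_nonneg fun k _ => hM0 _
  have key : ∀ h : Rn n', ‖S (fun y => g (x + h, y)) - S (fun y => g (x, y)) - L₀ h‖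
      ≤ C * B * ‖h‖ ^ 2 := by
    intro h
    let R : Rn n' × Rn n → ℂ := fun p => g (p + (h, 0)) - g p - fderiv ℝ g p (h, 0)
    have hR : ContDiff ℝ (⊤ : ℕ∞) R :=
      ((hg.comp (contDiff_id.add contDiff_const)).sub hg).sub (hg.fderiv_apply_const _)
    have e : S (fun y => g (x + h, y)) - S (fun y => g (x, y)) - L₀ h
        = S (fun y => R (x, y)) := by
      change S _ - S _ - S _ = _
      rw [← map_sub, ← map_sub]
      congr 1
      ext y
      simp [R]
    rw [e, mul_assoc]
    refine hS _ (hR.prodMk_right x) ?_ _ (by positivity) ?_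
    · refine closure_minimal (fun y hy => ?_) hK₂.isClosed
      by_contra hy2
      apply hy
      have h0 : ∀ x', g (x', y) = 0 := fun x' =>
        image_eq_zero_of_notMem_tsupport (fun h => hy2 (hs h).2)
      have h1 : fderiv ℝ g (x, y) = 0 :=
        image_eq_zero_of_notMem_tsupport
          (fun h => hy2 (hs (tsupport_fderiv_subset ℝ h)).2)
      simp [R, h0, h1]
    · intro y _ k hk
      refine (norm_iteratedFDeriv_prodMk_right_le hR k x y).trans ?_
      refine (norm_iteratedFDeriv_taylor_remainder_le k hg (hM (k + 2)) (h, 0) (x, y)).trans ?_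
      have h1 : ‖((h, 0) : Rn n' × Rn n)‖ = ‖h‖ := by simp [Prod.norm_def]
      rw [h1, mul_assoc, ← sq]
      gcongr
      exact Finset.single_le_sum (f := fun k => M (k + 2)) (fun k _ => hM0 _)
        (Finset.mem_range.mpr (by omega))
  rw [hasFDerivAt_iff_isLittleO_nhds_zero]
  refine Asymptotics.IsBigO.trans_isLittleO (g := fun h : Rn n' => ‖h‖ ^ 2) ?_ ?_
  · refine Asymptotics.IsBigO.of_bound (C * B) (Filter.Eventually.of_forall fun h => ?_)
    simpa using key h
  · exact Asymptotics.isLittleO_norm_pow_id one_lt_two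

lemma fderiv_slice_pairing (hS : IsBoundedOn S K₂ j C)
    (hK₁ : IsCompact K₁) (hK₂ : IsCompact K₂)
    (hg : ContDiff ℝ (⊤ : ℕ∞) g) (hs : tsupport g ⊆ K₁ ×ˢ K₂) (x h : Rn n') :
    fderiv ℝ (fun x => S (fun y => g (x, y))) x h = S (fun y => fderiv ℝ g (x, y) (h, 0)) := by
  obtain ⟨L, hL, hL'⟩ := hasFDerivAt_slice_pairing hS hK₁ hK₂ hg hs x
  rw [hL.fderiv, hL']

lemma contDiff_slice_pairing (hS : IsBoundedOn S K₂ j C)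
    (hK₁ : IsCompact K₁) (hK₂ : IsCompact K₂)
    (hg : ContDiff ℝ (⊤ : ℕ∞) g) (hs : tsupport g ⊆ K₁ ×ˢ K₂) :
    ContDiff ℝ (⊤ : ℕ∞) (fun x => S (fun y => g (x, y))) := by
  rw [contDiff_infty]
  intro m
  induction m generalizing g with
  | zero =>
    rw [Nat.cast_zero, contDiff_zero]
    refine continuous_iff_continuousAt.mpr fun x => ?_
    obtain ⟨L, hL, -⟩ := hasFDerivAt_slice_pairing hS hK₁ hK₂ hg hs x
    exact hL.continuousAt
  | succ m ih =>
    rw [Nat.cast_succ, contDiff_succ_iff_fderiv_apply]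
    refine ⟨fun x => ?_, fun h => by simp at h, fun h => ?_⟩
    · obtain ⟨L, hL, -⟩ := hasFDerivAt_slice_pairing hS hK₁ hK₂ hg hs x
      exact hL.differentiableAt
    · simp_rw [fderiv_slice_pairing hS hK₁ hK₂ hg hs]
      exact ih (hg.fderiv_apply_const (h, 0)) ((tsupport_fderiv_apply_subset ℝ _).trans hs)

lemma iteratedFDeriv_succ_slice_pairing_apply
    (hS : IsBoundedOn S K₂ j C) (hK₁ : IsCompact K₁) (hK₂ : IsCompact K₂)
    (hg : ContDiff ℝ (⊤ : ℕ∞) g) (hs : tsupport g ⊆ K₁ ×ˢ K₂) (i : ℕ) (x : Rn n')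
    (m : Fin (i + 1) → Rn n') :
    iteratedFDeriv ℝ (i + 1) (fun x => S (fun y => g (x, y))) x m =
      iteratedFDeriv ℝ i (fun x => S (fun y => fderiv ℝ g (x, y) (m (Fin.last i), 0))) x
        (Fin.init m) := by
  have hF := contDiff_slice_pairing hS hK₁ hK₂ hg hs
  rw [iteratedFDeriv_succ_apply_right, ← iteratedFDeriv_clm_apply_const_apply (n := (⊤ : ℕ∞))
    (hF.fderiv_right (by simp)) (by exact_mod_cast (le_top : (i : ℕ∞) ≤ ⊤))]
  simp_rw [fderiv_slice_pairing hS hK₁ hK₂ hg hs]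

lemma norm_iteratedFDeriv_slice_pairing_le
    (hS : IsBoundedOn S K₂ j C) (hC : 0 ≤ C) (hK₁ : IsCompact K₁) (hK₂ : IsCompact K₂)
    (hg : ContDiff ℝ (⊤ : ℕ∞) g) (hs : tsupport g ⊆ K₁ ×ˢ K₂) (i : ℕ) (x : Rn n')
    {B : ℝ} (hB : 0 ≤ B)
    (hbd : ∀ y ∈ K₂, ∀ k ≤ j + i, ‖iteratedFDeriv ℝ k g (x, y)‖ ≤ B) :
    ‖iteratedFDeriv ℝ i (fun x => S (fun y => g (x, y))) x‖ ≤ C * B := by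
  induction i generalizing g B with
  | zero =>
    rw [norm_iteratedFDeriv_zero]
    exact hS _ (hg.prodMk_right x) (tsupport_prodMk_right_subset hK₂.isClosed hs x) B hB
      fun y hy k hk => (norm_iteratedFDeriv_prodMk_right_le hg k x y).trans (hbd y hy k hk)
  | succ i ih =>
    refine ContinuousMultilinearMap.opNorm_le_bound (by positivity) fun m => ?_
    rw [iteratedFDeriv_succ_slice_pairing_apply hS hK₁ hK₂ hg hs]
    have h1 := ih (g := fun p => fderiv ℝ g p (m (Fin.last i), 0))
      (B := ‖m (Fin.last i)‖ * B) (hg.fderiv_apply_const _)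
      ((tsupport_fderiv_apply_subset ℝ _).trans hs) (by positivity) fun y hy k hk => by
        refine (norm_iteratedFDeriv_fderiv_apply_le hg _ k _).trans ?_
        have h1 : ‖((m (Fin.last i), 0) : Rn n' × Rn n)‖ = ‖m (Fin.last i)‖ := by
          simp [Prod.norm_def]
        rw [h1]
        gcongr
        exact hbd y hy (k + 1) (by omega)
    refine (ContinuousMultilinearMap.le_opNorm _ _).trans ?_
    rw [Fin.prod_univ_castSucc]
    refine (mul_le_mul_of_nonneg_right h1 (by positivity)).trans (le_of_eq ?_)
    simp only [Fin.init]
    ring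

end Slices

lemma IsDistributionOn.exists_isBoundedOn {n : ℕ} {Ω K : Set (Rn n)}
    {S : (Rn n → ℂ) →ₗ[ℂ] ℂ} (hS : IsDistributionOn Ω S) (hK : IsCompact K) (hKΩ : K ⊆ Ω) :
    ∃ j : ℕ, ∃ C : ℝ, IsBoundedOn S K j C := by
  obtain ⟨j, C, -, h⟩ := hS K hK hKΩ
  exact ⟨j, C, fun f hf hs B _ hB => h f hf.contDiffOn hs B hB⟩

lemma IsBoundedOn.sub {n : ℕ} {K : Set (Rn n)} {S S' : (Rn n → ℂ) →ₗ[ℂ] ℂ} {j j' : ℕ}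
    {C C' : ℝ} (h : IsBoundedOn S K j C) (h' : IsBoundedOn S' K j' C') :
    IsBoundedOn (S - S') K (max j j') (C + C') := by
  intro f hf hs B hB hbd
  rw [LinearMap.sub_apply, add_mul]
  exact (norm_sub_le _ _).trans (add_le_add
    (h f hf hs B hB fun x hx i hi => hbd x hx i (hi.trans (le_max_left _ _)))
    (h' f hf hs B hB fun x hx i hi => hbd x hx i (hi.trans (le_max_right _ _))))

lemma IsBasicNetC.exists_isBoundedOn {n : ℕ} {Ω K : Set (Rn n)}
    {T : ℝ → (Rn n → ℂ) →ₗ[ℂ] ℂ} (hT : IsBasicNetC Ω T) (hK : IsCompact K) (hKΩ : K ⊆ Ω) :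
    ∃ j N : ℕ, ∃ η ∈ Ioc (0:ℝ) 1, ∀ ε ∈ Ioc (0:ℝ) η,
      IsBoundedOn (T ε) K j (ε ^ (-(N:ℝ))) := by
  obtain ⟨j, N, η, hη, h⟩ := hT.2 K hK hKΩ
  exact ⟨j, N, η, hη, fun ε hε f hf hs B hB hbd => h ε hε f hf.contDiffOn hs B hB hbd⟩

/-- Finitely many eventual estimates hold simultaneously, with a common constant. -/
lemma exists_common_bound {ι : Type} (s : Finset ι) {P : ι → ℝ → ℝ → Prop}
    (hmono : ∀ i, ∀ ε > 0, ∀ c c', c ≤ c' → P i c ε → P i c' ε)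
    (h : ∀ i ∈ s, ∃ c > 0, ∃ η ∈ Ioc (0:ℝ) 1, ∀ ε ∈ Ioc (0:ℝ) η, P i c ε) :
    ∃ c > 0, ∃ η ∈ Ioc (0:ℝ) 1, ∀ ε ∈ Ioc (0:ℝ) η, ∀ i ∈ s, P i c ε := by
  classical
  induction s using Finset.induction_on with
  | empty => exact ⟨1, one_pos, 1, ⟨one_pos, le_rfl⟩, by simp⟩
  | insert a s _ ih =>
    obtain ⟨c, hc, η, hη, H⟩ := ih fun i hi => h i (Finset.mem_insert_of_mem hi)
    obtain ⟨c', hc', η', hη', H'⟩ := h a (Finset.mem_insert_self a s)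
    refine ⟨max c c', lt_max_of_lt_left hc, min η η',
      ⟨lt_min hη.1 hη'.1, (min_le_left _ _).trans hη.2⟩, fun ε hε i hi => ?_⟩
    rcases Finset.mem_insert.mp hi with rfl | hi
    · exact hmono _ ε hε.1 _ _ (le_max_right _ _)
        (H' ε ⟨hε.1, hε.2.trans (min_le_right _ _)⟩)
    · exact hmono _ ε hε.1 _ _ (le_max_left _ _)
        (H ε ⟨hε.1, hε.2.trans (min_le_left _ _)⟩ i hi)

section Nets

variable {E : Type} [NormedAddCommGroup E] [NormedSpace ℝ E] {Ω : Set E} {u : ℝ → E → ℂ}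

lemma IsNegligible.exists_bound_le (hu : IsNegligible Ω u) {K : Set E} (hK : IsCompact K)
    (hKΩ : K ⊆ Ω) (m q : ℕ) :
    ∃ c > 0, ∃ η ∈ Ioc (0:ℝ) 1, ∀ ε ∈ Ioc (0:ℝ) η, ∀ i ≤ m, ∀ x ∈ K,
      ‖iteratedFDeriv ℝ i (u ε) x‖ ≤ c * ε ^ (q:ℝ) := by
  obtain ⟨c, hc, η, hη, H⟩ := exists_common_bound (Finset.range (m + 1))
    (P := fun i c ε => ∀ x ∈ K, ‖iteratedFDeriv ℝ i (u ε) x‖ ≤ c * ε ^ (q:ℝ))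
    (fun i ε hε c c' hcc h x hx => (h x hx).trans (by gcongr))
    (fun i _ => hu.2 K hK hKΩ i q)
  exact ⟨c, hc, η, hη, fun ε hε i hi => H ε hε i (Finset.mem_range.mpr (by omega))⟩

lemma IsModerate.exists_bound_le (hu : IsModerate Ω u) {K : Set E} (hK : IsCompact K)
    (hKΩ : K ⊆ Ω) (m : ℕ) :
    ∃ N : ℕ, ∃ c > 0, ∃ η ∈ Ioc (0:ℝ) 1, ∀ ε ∈ Ioc (0:ℝ) η, ∀ i ≤ m, ∀ x ∈ K,
      ‖iteratedFDeriv ℝ i (u ε) x‖ ≤ c * ε ^ (-(N:ℝ)) := by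
  choose N c hc η hη H using hu.2 K hK hKΩ
  set M := ∑ i ∈ Finset.range (m + 1), N i with hM
  obtain ⟨c', hc', η', hη', H'⟩ := exists_common_bound (Finset.range (m + 1))
    (P := fun i c ε => ∀ x ∈ K, ‖iteratedFDeriv ℝ i (u ε) x‖ ≤ c * ε ^ (-(M:ℝ)))
    (fun i ε hε c c' hcc h x hx => (h x hx).trans (by gcongr))
    (fun i hi => ⟨c i, hc i, η i, hη i, fun ε hε x hx => (H i ε hε x hx).trans (by
      have hci := hc i
      have hNM : N i ≤ M := Finset.single_le_sum (f := N) (fun _ _ => Nat.zero_le _) hi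
      gcongr ?_ * ?_
      exact Real.rpow_le_rpow_of_exponent_ge hε.1 (hε.2.trans (hη i).2)
        (neg_le_neg (Nat.cast_le.mpr hNM)))⟩)
  exact ⟨M, c', hc', η', hη', fun ε hε i hi => H' ε hε i (Finset.mem_range.mpr (by omega))⟩

lemma IsModerate.fderiv_apply_const (hu : IsModerate Ω u)
    (hs : ∀ ε ∈ Ioc (0:ℝ) 1, ContDiff ℝ (⊤ : ℕ∞) (u ε)) (v : E) :
    IsModerate Ω (fun ε p => fderiv ℝ (u ε) p v) := by
  refine ⟨fun ε hε => ((hs ε hε).fderiv_apply_const v).contDiffOn, fun K hK hKΩ i => ?_⟩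
  obtain ⟨N, c, hc, η, hη, H⟩ := hu.2 K hK hKΩ (i + 1)
  refine ⟨N, (‖v‖ + 1) * c, by positivity, η, hη, fun ε hε x hx => ?_⟩
  refine (norm_iteratedFDeriv_fderiv_apply_le (hs ε ⟨hε.1, hε.2.trans hη.2⟩) v i x).trans ?_
  rw [mul_assoc]
  gcongr
  · linarith
  · exact H ε hε x hx

end Nets

/-- Bounding a derivative of order `i + 1` by the derivatives of order `i` of the partial
derivatives. -/
lemma norm_iteratedFDeriv_succ_le_of_single {n : ℕ} {f : Rn n → ℂ}
    (hf : ContDiff ℝ (⊤ : ℕ∞) f) (i : ℕ) (x : Rn n) {B : ℝ} (hB : 0 ≤ B)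
    (h : ∀ e : Fin n,
      ‖iteratedFDeriv ℝ i (fun x => fderiv ℝ f x (EuclideanSpace.single e 1)) x‖ ≤ B) :
    ‖iteratedFDeriv ℝ (i + 1) f x‖ ≤ n * B := by
  refine ContinuousMultilinearMap.opNorm_le_bound (by positivity) fun m => ?_
  rw [iteratedFDeriv_succ_apply_right]
  have hsum : m (Fin.last i) = ∑ e, (m (Fin.last i)) e • EuclideanSpace.single e (1:ℝ) := by
    have := (EuclideanSpace.basisFun (Fin n) ℝ).sum_repr (m (Fin.last i))
    simpa using this.symm
  conv_lhs => rw [hsum]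
  rw [map_sum, Fin.prod_univ_castSucc]
  refine (norm_sum_le _ _).trans ?_
  have hterm : ∀ e ∈ Finset.univ,
      ‖iteratedFDeriv ℝ i (fun y => fderiv ℝ f y) x (Fin.init m)
        ((m (Fin.last i)) e • EuclideanSpace.single e (1:ℝ))‖
      ≤ B * ((∏ k : Fin i, ‖m k.castSucc‖) * ‖m (Fin.last i)‖) := by
    intro e _
    rw [map_smul, ← iteratedFDeriv_clm_apply_const_apply (n := (⊤ : ℕ∞))
      (hf.fderiv_right (by simp)) (by exact_mod_cast (le_top : (i : ℕ∞) ≤ ⊤)), norm_smul]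
    have h1 := (ContinuousMultilinearMap.le_opNorm
      (iteratedFDeriv ℝ i (fun x => fderiv ℝ f x (EuclideanSpace.single e 1)) x)
        (Fin.init m)).trans (mul_le_mul_of_nonneg_right (h e) (by positivity))
    calc _ ≤ ‖m (Fin.last i)‖ * (B * ∏ k, ‖(Fin.init m : Fin i → Rn n) k‖) := by
          gcongr
          exact PiLp.norm_apply_le _ _
      _ = _ := by simp only [Fin.init]; ring
  refine (Finset.sum_le_sum hterm).trans (le_of_eq ?_)
  simp only [Finset.sum_const, Finset.card_univ, Fintype.card_fin, nsmul_eq_mul]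
  ring

section Pairings

variable {n' n : ℕ} {Ω' : Set (Rn n')} {Ω : Set (Rn n)} {T : ℝ → (Rn n → ℂ) →ₗ[ℂ] ℂ}
  {u : ℝ → (Rn n' × Rn n) → ℂ} {K₁ : Set (Rn n')} {K₂ : Set (Rn n)}

lemma IsBasicNetC.isModerate_slice_pairing (hT : IsBasicNetC Ω T)
    (hu : IsModerate (Ω' ×ˢ Ω) u) (hK₁ : IsCompact K₁) (hK₂ : IsCompact K₂) (hK₂Ω : K₂ ⊆ Ω)
    (hsm : ∀ ε ∈ Ioc (0:ℝ) 1, ContDiff ℝ (⊤ : ℕ∞) (u ε))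
    (hsupp : ∀ ε ∈ Ioc (0:ℝ) 1, tsupport (u ε) ⊆ K₁ ×ˢ K₂) :
    IsModerate Ω' (fun ε x => T ε (fun y => u ε (x, y))) := by
  constructor
  · intro ε hε
    obtain ⟨j, C, h⟩ := (hT.1 ε hε).exists_isBoundedOn hK₂ hK₂Ω
    exact (contDiff_slice_pairing h hK₁ hK₂ (hsm ε hε) (hsupp ε hε)).contDiffOn
  · intro K hK hKΩ i
    obtain ⟨j, N, η, hη, hbT⟩ := hT.exists_isBoundedOn hK₂ hK₂Ω
    obtain ⟨N', c, hc, η', hη', hbu⟩ :=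
      hu.exists_bound_le (hK.prod hK₂) (prod_mono hKΩ hK₂Ω) (j + i)
    refine ⟨N + N', c, hc, min η η', ⟨lt_min hη.1 hη'.1, (min_le_left _ _).trans hη.2⟩,
      fun ε hε x hx => ?_⟩
    have hε0 : 0 < ε := hε.1
    have hε1 : ε ∈ Ioc 0 η := ⟨hε.1, hε.2.trans (min_le_left _ _)⟩
    have hε2 : ε ∈ Ioc 0 η' := ⟨hε.1, hε.2.trans (min_le_right _ _)⟩
    have hε3 : ε ∈ Ioc (0:ℝ) 1 := ⟨hε.1, hε1.2.trans hη.2⟩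
    refine (norm_iteratedFDeriv_slice_pairing_le (hbT ε hε1) (by positivity) hK₁ hK₂
      (hsm ε hε3) (hsupp ε hε3) i x (B := c * ε ^ (-(N':ℝ))) (by positivity)
      fun y hy k hk => hbu ε hε2 k hk (x, y) ⟨hx, hy⟩).trans (le_of_eq ?_)
    rw [Nat.cast_add, neg_add, Real.rpow_add hε0]
    ring

lemma IsBasicNetC.isNegligible_slice_pairing (hT : IsBasicNetC Ω T)
    (hu : IsNegligible (Ω' ×ˢ Ω) u) (hK₁ : IsCompact K₁) (hK₂ : IsCompact K₂) (hK₂Ω : K₂ ⊆ Ω)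
    (hsm : ∀ ε ∈ Ioc (0:ℝ) 1, ContDiff ℝ (⊤ : ℕ∞) (u ε))
    (hsupp : ∀ ε ∈ Ioc (0:ℝ) 1, tsupport (u ε) ⊆ K₁ ×ˢ K₂) :
    IsNegligible Ω' (fun ε x => T ε (fun y => u ε (x, y))) := by
  constructor
  · intro ε hε
    obtain ⟨j, C, h⟩ := (hT.1 ε hε).exists_isBoundedOn hK₂ hK₂Ω
    exact (contDiff_slice_pairing h hK₁ hK₂ (hsm ε hε) (hsupp ε hε)).contDiffOn
  · intro K hK hKΩ i q
    obtain ⟨j, N, η, hη, hbT⟩ := hT.exists_isBoundedOn hK₂ hK₂Ω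
    obtain ⟨c, hc, η', hη', hbu⟩ :=
      hu.exists_bound_le (hK.prod hK₂) (prod_mono hKΩ hK₂Ω) (j + i) (q + N)
    refine ⟨c, hc, min η η', ⟨lt_min hη.1 hη'.1, (min_le_left _ _).trans hη.2⟩,
      fun ε hε x hx => ?_⟩
    have hε0 : 0 < ε := hε.1
    have hε1 : ε ∈ Ioc 0 η := ⟨hε.1, hε.2.trans (min_le_left _ _)⟩
    have hε2 : ε ∈ Ioc 0 η' := ⟨hε.1, hε.2.trans (min_le_right _ _)⟩
    have hε3 : ε ∈ Ioc (0:ℝ) 1 := ⟨hε.1, hε1.2.trans hη.2⟩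
    refine (norm_iteratedFDeriv_slice_pairing_le (hbT ε hε1) (by positivity) hK₁ hK₂
      (hsm ε hε3) (hsupp ε hε3) i x (B := c * ε ^ ((q + N : ℕ):ℝ)) (by positivity)
      fun y hy k hk => hbu ε hε2 k hk (x, y) ⟨hx, hy⟩).trans (le_of_eq ?_)
    rw [mul_left_comm, ← Real.rpow_add hε0]
    congr 2
    push_cast
    ring

/-- A net of functionals vanishing on `G_c(Ω)` gives a negligible net when paired with the
slices of a moderate, compactly supported net. -/
lemma exists_bound_slice_pairing_of_vanishing
    (hT : ∀ ε ∈ Ioc (0:ℝ) 1, ∃ j : ℕ, ∃ C : ℝ, IsBoundedOn (T ε) K₂ j C)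
    (hzero : ∀ v : ℝ → Rn n → ℂ, IsModerate Ω v → HasCmpSupp Ω v →
      CIsNegligible (fun ε => T ε (v ε)))
    (hK₁ : IsCompact K₁) (hK₂ : IsCompact K₂) (hK₂Ω : K₂ ⊆ Ω)
    {K : Set (Rn n')} (hK : IsCompact K) (hKΩ : K ⊆ Ω') (i q : ℕ)
    (hu : IsModerate (Ω' ×ˢ Ω) u)
    (hsm : ∀ ε ∈ Ioc (0:ℝ) 1, ContDiff ℝ (⊤ : ℕ∞) (u ε))
    (hsupp : ∀ ε ∈ Ioc (0:ℝ) 1, tsupport (u ε) ⊆ K₁ ×ˢ K₂) :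
    ∃ c > 0, ∃ η ∈ Ioc (0:ℝ) 1, ∀ ε ∈ Ioc (0:ℝ) η, ∀ x ∈ K,
      ‖iteratedFDeriv ℝ i (fun x => T ε (fun y => u ε (x, y))) x‖ ≤ c * ε ^ (q:ℝ) := by
  have hF : ∀ ε ∈ Ioc (0:ℝ) 1, ContDiff ℝ (⊤ : ℕ∞) (fun x => T ε (fun y => u ε (x, y))) := by
    intro ε hε
    obtain ⟨j, C, h⟩ := hT ε hε
    exact contDiff_slice_pairing h hK₁ hK₂ (hsm ε hε) (hsupp ε hε)
  induction i generalizing u with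
  | zero =>
    rcases K.eq_empty_or_nonempty with rfl | hne
    · exact ⟨1, one_pos, 1, ⟨one_pos, le_rfl⟩, by simp⟩
    have hmax : ∀ ε : ℝ, ∃ x₀ ∈ K, ε ∈ Ioc (0:ℝ) 1 →
        ∀ x ∈ K, ‖T ε (fun y => u ε (x, y))‖ ≤ ‖T ε (fun y => u ε (x₀, y))‖ := by
      intro ε
      by_cases hε : ε ∈ Ioc (0:ℝ) 1
      · obtain ⟨x₀, hx₀, h⟩ := hK.exists_isMaxOn hne (hF ε hε).continuous.norm.continuousOn
        exact ⟨x₀, hx₀, fun _ x hx => h hx⟩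
      · exact ⟨hne.some, hne.some_mem, fun h => absurd h hε⟩
    choose x₀ hx₀ hmax using hmax
    obtain ⟨c, hc, η, hη, H⟩ := hzero (fun ε y => u ε (x₀ ε, y))
      ⟨fun ε hε => ((hsm ε hε).prodMk_right _).contDiffOn, fun L hL hLΩ k => by
        obtain ⟨N, c, hc, η, hη, H⟩ := hu.2 (K ×ˢ L) (hK.prod hL) (prod_mono hKΩ hLΩ) k
        exact ⟨N, c, hc, η, hη, fun ε hε y hy =>
          (norm_iteratedFDeriv_prodMk_right_le (hsm ε ⟨hε.1, hε.2.trans hη.2⟩) k _ y).trans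
            (H ε hε _ ⟨hx₀ ε, hy⟩)⟩⟩
      ⟨K₂, hK₂, hK₂Ω, fun ε hε =>
        tsupport_prodMk_right_subset hK₂.isClosed (hsupp ε hε) _⟩ q
    refine ⟨c, hc, η, hη, fun ε hε x hx => ?_⟩
    rw [norm_iteratedFDeriv_zero]
    exact (hmax ε ⟨hε.1, hε.2.trans hη.2⟩ x hx).trans (H ε hε)
  | succ i ih =>
    have hstep : ∀ v : Rn n' × Rn n, _ := fun v =>
      ih (hu.fderiv_apply_const hsm v) (fun ε hε => (hsm ε hε).fderiv_apply_const v)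
        (fun ε hε => (tsupport_fderiv_apply_subset ℝ _).trans (hsupp ε hε)) (fun ε hε => by
          obtain ⟨j, C, h⟩ := hT ε hε
          exact contDiff_slice_pairing h hK₁ hK₂ ((hsm ε hε).fderiv_apply_const v)
            ((tsupport_fderiv_apply_subset ℝ _).trans (hsupp ε hε)))
    obtain ⟨c, hc, η, hη, H⟩ := exists_common_bound (Finset.univ : Finset (Fin n'))
      (P := fun e c ε => ∀ x ∈ K, ‖iteratedFDeriv ℝ i (fun x => T ε (fun y =>
        fderiv ℝ (u ε) (x, y) (EuclideanSpace.single e 1, 0))) x‖ ≤ c * ε ^ (q:ℝ))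
      (fun e ε hε c c' hcc h x hx => (h x hx).trans (by gcongr))
      (fun e _ => hstep (EuclideanSpace.single e 1, 0))
    refine ⟨n' * c + 1, by positivity, η, hη, fun ε hε x hx => ?_⟩
    have hε0 : 0 < ε := hε.1
    have hε1 : ε ∈ Ioc (0:ℝ) 1 := ⟨hε.1, hε.2.trans hη.2⟩
    obtain ⟨j, C, h⟩ := hT ε hε1
    refine (norm_iteratedFDeriv_succ_le_of_single (hF ε hε1) i x (B := c * ε ^ (q:ℝ))
      (by positivity) fun e => ?_).trans ?_
    · simp_rw [fderiv_slice_pairing h hK₁ hK₂ (hsm ε hε1) (hsupp ε hε1)]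
      exact H ε hε e (Finset.mem_univ e) x hx
    · rw [← mul_assoc]
      gcongr
      linarith

end Pairings

end Colombeau


/-- Let `Ω' ⊆ ℝ^{n'}` and `Ω ⊆ ℝ^n` be open and let `T` be a basic
functional in `L(G_c(Ω),ℂ̃)`, defined by a net `(T_ε)` of distributions.  For every
`u ∈ G_c(Ω'×Ω)`, choosing a representative `(u_ε)` whose supports are all contained in a
fixed compact `K₁ × K₂ ⊆ Ω' × Ω`, the net `x ↦ T_ε(u_ε(x,·))` is a moderate net of smooth
functions on `Ω'` with supports in `K₁`; its class is unchanged if `(u_ε)` is replaced by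
another representative of `u` or `(T_ε)` by another net defining `T`, so that
`T(u(x,·)) := [(T_ε(u_ε(x,·)))_ε]` is a well-defined element of `G_c(Ω')`. -/
theorem statement0
    {n' n : ℕ} (Ω' : Set (Rn n')) (Ω : Set (Rn n))
    (hΩ' : IsOpen Ω') (hΩ : IsOpen Ω)
    (T : ℝ → (Rn n → ℂ) →ₗ[ℂ] ℂ) (hT : IsBasicNetC Ω T)
    (u : ℝ → (Rn n' × Rn n) → ℂ)
    (hu : IsModerate (Ω' ×ˢ Ω) u)
    (K₁ : Set (Rn n')) (K₂ : Set (Rn n))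
    (hK₁ : IsCompact K₁) (hK₁Ω : K₁ ⊆ Ω') (hK₂ : IsCompact K₂) (hK₂Ω : K₂ ⊆ Ω)
    (hsupp : ∀ ε ∈ Ioc (0:ℝ) 1, tsupport (u ε) ⊆ K₁ ×ˢ K₂) :
    -- the net `x ↦ T_ε(u_ε(x,·))` is moderate on `Ω'` with supports in `K₁`
    (IsModerate Ω' (fun ε x => T ε (fun y => u ε (x, y))) ∧
      ∀ ε ∈ Ioc (0:ℝ) 1, tsupport (fun x => T ε (fun y => u ε (x, y))) ⊆ K₁) ∧
    -- independence of the representative of `u`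
    (∀ u' : ℝ → (Rn n' × Rn n) → ℂ, ∀ K₁' : Set (Rn n'), ∀ K₂' : Set (Rn n),
      IsCompact K₁' → K₁' ⊆ Ω' → IsCompact K₂' → K₂' ⊆ Ω →
      IsModerate (Ω' ×ˢ Ω) u' →
      (∀ ε ∈ Ioc (0:ℝ) 1, tsupport (u' ε) ⊆ K₁' ×ˢ K₂') →
      IsNegligible (Ω' ×ˢ Ω) (fun ε p => u ε p - u' ε p) →
      IsNegligible Ω' (fun ε x => T ε (fun y => u ε (x, y)) - T ε (fun y => u' ε (x, y)))) ∧
    -- independence of the net defining `T`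
    (∀ T' : ℝ → (Rn n → ℂ) →ₗ[ℂ] ℂ, IsBasicNetC Ω T' →
      (∀ v : ℝ → Rn n → ℂ, IsModerate Ω v → HasCmpSupp Ω v →
        CIsNegligible (fun ε => T ε (v ε) - T' ε (v ε))) →
      IsNegligible Ω' (fun ε x => T ε (fun y => u ε (x, y)) - T' ε (fun y => u ε (x, y)))) := by
  have hglob : ∀ (w : ℝ → (Rn n' × Rn n) → ℂ) (L₁ : Set (Rn n')) (L₂ : Set (Rn n)),
      L₁ ⊆ Ω' → L₂ ⊆ Ω → IsModerate (Ω' ×ˢ Ω) w →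
      (∀ ε ∈ Ioc (0:ℝ) 1, tsupport (w ε) ⊆ L₁ ×ˢ L₂) →
      ∀ ε ∈ Ioc (0:ℝ) 1, ContDiff ℝ (⊤ : ℕ∞) (w ε) := fun w L₁ L₂ h₁ h₂ hw hs ε hε =>
    contDiff_of_tsupport_subset (hΩ'.prod hΩ) (hw.1 ε hε) ((hs ε hε).trans (prod_mono h₁ h₂))
  have hsm := hglob u K₁ K₂ hK₁Ω hK₂Ω hu hsupp
  refine ⟨⟨hT.isModerate_slice_pairing hu hK₁ hK₂ hK₂Ω hsm hsupp, fun ε hε =>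
    tsupport_slice_pairing_subset hK₁.isClosed (hsupp ε hε)⟩, ?_, ?_⟩
  · intro u' K₁' K₂' hK₁' hK₁Ω' hK₂' hK₂Ω' hu' hsupp' hneg
    have hsm' := hglob u' K₁' K₂' hK₁Ω' hK₂Ω' hu' hsupp'
    have h := hT.isNegligible_slice_pairing hneg (hK₁.union hK₁') (hK₂.union hK₂')
      (union_subset hK₂Ω hK₂Ω') (fun ε hε => (hsm ε hε).sub (hsm' ε hε)) (fun ε hε =>
        (tsupport_sub (u ε) (u' ε)).trans (union_subset
          ((hsupp ε hε).trans (prod_mono subset_union_left subset_union_left))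
          ((hsupp' ε hε).trans (prod_mono subset_union_right subset_union_right))))
    convert h using 3 with ε x
    rw [← map_sub]
    rfl
  · intro T' hT' hTT'
    have hb : ∀ ε ∈ Ioc (0:ℝ) 1, ∃ j : ℕ, ∃ C : ℝ, IsBoundedOn (T ε - T' ε) K₂ j C := by
      intro ε hε
      obtain ⟨j, C, h⟩ := (hT.1 ε hε).exists_isBoundedOn hK₂ hK₂Ω
      obtain ⟨j', C', h'⟩ := (hT'.1 ε hε).exists_isBoundedOn hK₂ hK₂Ω
      exact ⟨_, _, h.sub h'⟩
    refine ⟨fun ε hε => ?_, fun K hK hKΩ i q =>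
      exists_bound_slice_pairing_of_vanishing (T := fun ε => T ε - T' ε) hb hTT' hK₁ hK₂ hK₂Ω
        hK hKΩ i q hu hsm hsupp⟩
    obtain ⟨j, C, h⟩ := hb ε hε
    exact (contDiff_slice_pairing h hK₁ hK₂ (hsm ε hε) (hsupp ε hε)).contDiffOn
end
end

section
/- Let Ω' ⊆ ℝ^{n'} and Ω ⊆ ℝ^n be open and let T be a basic functional in L(G(Ω),ℂ̃), defined by a net (T_ε) of compactly supported distributions. If u ∈ G(Ω'×Ω) then T(u(x,·)) := [(T_ε(u_ε(x,·)))_ε] is a well-defined element of G(Ω'); if moreover u ∈ G^∞(Ω'×Ω) then T(u(x,·)) ∈ G^∞(Ω'). -/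
noncomputable section

open Set MeasureTheory Topology

open Colombeau

open Filter

namespace Colombeau

section Calculus

variable {X Y G : Type} [NormedAddCommGroup X] [NormedSpace ℝ X]
  [NormedAddCommGroup Y] [NormedSpace ℝ Y] [NormedAddCommGroup G] [NormedSpace ℝ G]

theorem contDiffOn_fderiv {U : Set X} (hU : IsOpen U) {w : X → G}
    (hw : ContDiffOn ℝ (⊤ : ℕ∞) w U) : ContDiffOn ℝ (⊤ : ℕ∞) (fderiv ℝ w) U :=
  hw.fderiv_of_isOpen hU (by simp)

theorem contDiffOn_fderiv_apply {U : Set X} (hU : IsOpen U) {w : X → G}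
    (hw : ContDiffOn ℝ (⊤ : ℕ∞) w U) (e : X) :
    ContDiffOn ℝ (⊤ : ℕ∞) (fun p => fderiv ℝ w p e) U :=
  (contDiffOn_fderiv hU hw).clm_apply contDiffOn_const

theorem contDiffOn_fderiv_comp_inr {U : Set (X × Y)} (hU : IsOpen U) {w : X × Y → G}
    (hw : ContDiffOn ℝ (⊤ : ℕ∞) w U) :
    ContDiffOn ℝ (⊤ : ℕ∞) (fun p => (fderiv ℝ w p).comp (ContinuousLinearMap.inr ℝ X Y)) U :=
  (contDiffOn_fderiv hU hw).clm_comp contDiffOn_const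

theorem contDiffOn_slice {Ω' : Set X} {Ω : Set Y} {w : X × Y → G}
    (hw : ContDiffOn ℝ (⊤ : ℕ∞) w (Ω' ×ˢ Ω)) {x : X} (hx : x ∈ Ω') :
    ContDiffOn ℝ (⊤ : ℕ∞) (fun y => w (x, y)) Ω :=
  hw.comp (contDiff_prodMk_right x).contDiffOn fun _ hy => ⟨hx, hy⟩

theorem hasFDerivAt_of_contDiffOn {U : Set X} (hU : IsOpen U) {w : X → G}
    (hw : ContDiffOn ℝ (⊤ : ℕ∞) w U) {p : X} (hp : p ∈ U) :
    HasFDerivAt w (fderiv ℝ w p) p :=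
  ((hw.contDiffAt (hU.mem_nhds hp)).differentiableAt (by simp)).hasFDerivAt

/-- The partial derivatives in the second variable are dominated by the full derivatives. -/
theorem norm_iteratedFDeriv_slice_le {Ω' : Set X} {Ω : Set Y} (hΩ' : IsOpen Ω') (hΩ : IsOpen Ω)
    (i : ℕ) : ∀ {G : Type} [NormedAddCommGroup G] [NormedSpace ℝ G] {w : X × Y → G},
      ContDiffOn ℝ (⊤ : ℕ∞) w (Ω' ×ˢ Ω) → ∀ {x : X} {y : Y}, x ∈ Ω' → y ∈ Ω →
        ‖iteratedFDeriv ℝ i (fun y => w (x, y)) y‖ ≤ ‖iteratedFDeriv ℝ i w (x, y)‖ := by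
  have hU := hΩ'.prod hΩ
  induction i with
  | zero => intro G _ _ w hw x y hx hy; simp
  | succ i ih =>
    intro G _ _ w hw x y hx hy
    have hD := contDiffOn_fderiv hU hw
    have hev : fderiv ℝ (fun y => w (x, y)) =ᶠ[𝓝 y]
        fun y => (fderiv ℝ w (x, y)).comp (ContinuousLinearMap.inr ℝ X Y) := by
      filter_upwards [hΩ.mem_nhds hy] with z hz
      exact ((hasFDerivAt_of_contDiffOn hU hw (p := (x, z)) ⟨hx, hz⟩).comp z
        (hasFDerivAt_prodMk_right x z)).fderiv
    rw [← norm_iteratedFDeriv_fderiv, ← norm_iteratedFDeriv_fderiv,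
      (hev.iteratedFDeriv ℝ i).eq_of_nhds]
    refine (ih (contDiffOn_fderiv_comp_inr hU hw) hx hy).trans ?_
    let L := (ContinuousLinearMap.compL ℝ Y (X × Y) G).flip (ContinuousLinearMap.inr ℝ X Y)
    have hL : ‖L‖ ≤ 1 := by
      refine ContinuousLinearMap.opNorm_le_bound _ zero_le_one fun A => ?_
      have h1 := ContinuousLinearMap.opNorm_comp_le A (ContinuousLinearMap.inr ℝ X Y)
      have h2 := ContinuousLinearMap.norm_inr_le_one ℝ X Y
      calc ‖L A‖ ≤ ‖A‖ * ‖ContinuousLinearMap.inr ℝ X Y‖ := h1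
        _ ≤ 1 * ‖A‖ := by nlinarith [norm_nonneg A]
    have h3 := L.norm_iteratedFDeriv_comp_left (n := i)
      (hD.contDiffAt (hU.mem_nhds (⟨hx, hy⟩ : (x, y) ∈ Ω' ×ˢ Ω))) (by exact_mod_cast le_top)
    refine h3.trans ?_
    nlinarith [norm_nonneg (iteratedFDeriv ℝ i (fderiv ℝ w) (x, y))]

theorem norm_iteratedFDeriv_fderiv_apply_le_s2 {U : Set X} (hU : IsOpen U) {w : X → G}
    (hw : ContDiffOn ℝ (⊤ : ℕ∞) w U) {p : X} (hp : p ∈ U) (e : X) (i : ℕ) :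
    ‖iteratedFDeriv ℝ i (fun p => fderiv ℝ w p e) p‖ ≤ ‖e‖ * ‖iteratedFDeriv ℝ (i + 1) w p‖ := by
  rw [← norm_iteratedFDeriv_fderiv]
  exact norm_iteratedFDeriv_clm_apply_const
    ((contDiffOn_fderiv hU hw).contDiffAt (hU.mem_nhds hp)) (by exact_mod_cast le_top)

/-- The first-order Taylor remainder in the first variable is `o(‖z - x‖)` with all its
derivatives in the second variable, uniformly on compact sets. -/
theorem eventually_norm_iteratedFDeriv_remainder_le {Ω' : Set X} {Ω K : Set Y}
    (hΩ' : IsOpen Ω') (hΩ : IsOpen Ω) (hK : IsCompact K) (hKΩ : K ⊆ Ω) {x : X} (hx : x ∈ Ω')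
    (i : ℕ) : ∀ {G : Type} [NormedAddCommGroup G] [NormedSpace ℝ G] {w : X × Y → G},
      ContDiffOn ℝ (⊤ : ℕ∞) w (Ω' ×ˢ Ω) → ∀ c > 0, ∀ᶠ z in 𝓝 x, ∀ y ∈ K,
        ‖iteratedFDeriv ℝ i (fun y => w (z, y) - w (x, y) - fderiv ℝ w (x, y) (z - x, 0)) y‖
          ≤ c * ‖z - x‖ := by
  have hU := hΩ'.prod hΩ
  induction i with
  | zero =>
    intro G _ _ w hw c hc
    have hD := contDiffOn_fderiv hU hw
    obtain ⟨v, hv, hvK⟩ := hK.mem_uniformity_of_prod (f := fun a b => fderiv ℝ w (a, b))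
      (s := Ω') (hD.continuousOn.mono (Set.prod_mono_right hKΩ)) hx (Metric.dist_mem_uniformity hc)
    rw [hΩ'.nhdsWithin_eq hx] at hv
    obtain ⟨r, hr, hrv⟩ := Metric.mem_nhds_iff.1 (Filter.inter_mem hv (hΩ'.mem_nhds hx))
    filter_upwards [Metric.ball_mem_nhds x hr] with z hz y hy
    rw [norm_iteratedFDeriv_zero]
    have key := Convex.norm_image_sub_le_of_norm_hasFDerivWithin_le' (𝕜 := ℝ)
      (f := fun a => w (a, y))
      (f' := fun a => (fderiv ℝ w (a, y)).comp (ContinuousLinearMap.inl ℝ X Y))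
      (φ := (fderiv ℝ w (x, y)).comp (ContinuousLinearMap.inl ℝ X Y))
      (C := c) (s := Metric.ball x r) (x := x) (y := z)
      (fun a ha => ((hasFDerivAt_of_contDiffOn hU hw (p := (a, y))
        ⟨(hrv ha).2, hKΩ hy⟩).comp a (hasFDerivAt_prodMk_left a y)).hasFDerivWithinAt)
      (fun a ha => by
        rw [← ContinuousLinearMap.sub_comp]
        have h1 := ContinuousLinearMap.opNorm_comp_le (fderiv ℝ w (a, y) - fderiv ℝ w (x, y))
          (ContinuousLinearMap.inl ℝ X Y)
        have h2 := ContinuousLinearMap.norm_inl_le_one ℝ X Y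
        have h3 : dist (fderiv ℝ w (a, y)) (fderiv ℝ w (x, y)) < c := hvK a (hrv ha).1 y hy
        rw [dist_eq_norm] at h3
        nlinarith [norm_nonneg (fderiv ℝ w (a, y) - fderiv ℝ w (x, y))])
      (convex_ball x r) (Metric.mem_ball_self hr) hz
    simpa using key
  | succ i ih =>
    intro G _ _ w hw c hc
    have hD := contDiffOn_fderiv hU hw
    filter_upwards [ih (contDiffOn_fderiv_comp_inr hU hw) c hc, hΩ'.mem_nhds hx] with z hz hzΩ y hy
    refine le_trans (le_of_eq ?_) (hz y hy)
    rw [← norm_iteratedFDeriv_fderiv]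
    congr 1
    refine Filter.EventuallyEq.eq_of_nhds (Filter.EventuallyEq.iteratedFDeriv ℝ ?_ i)
    filter_upwards [hΩ.mem_nhds (hKΩ hy)] with t ht
    have hp : (x, t) ∈ Ω' ×ˢ Ω := ⟨hx, ht⟩
    have h1 := (hasFDerivAt_of_contDiffOn hU hw (p := (z, t)) ⟨hzΩ, ht⟩).comp t
      (hasFDerivAt_prodMk_right z t)
    have h2 := (hasFDerivAt_of_contDiffOn hU hw hp).comp t (hasFDerivAt_prodMk_right x t)
    have hDD := hasFDerivAt_of_contDiffOn hU hD hp
    have h3 := (hDD.comp t (hasFDerivAt_prodMk_right x t)).clm_apply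
      (hasFDerivAt_const ((z - x, 0) : X × Y) t)
    have h4 := hDD.clm_comp (hasFDerivAt_const (ContinuousLinearMap.inr ℝ X Y) (x, t))
    have hsymm : IsSymmSndFDerivAt ℝ w (x, t) :=
      (hw.contDiffAt (hU.mem_nhds hp)).isSymmSndFDerivAt (by
        rw [minSmoothness_of_isRCLikeNormedField]; exact WithTop.coe_le_coe.2 (le_top : (2 : ℕ∞) ≤ ⊤))
    rw [h4.fderiv]
    refine ((h1.sub h2).sub h3).fderiv.trans ?_
    ext k
    simp [hsymm.eq (0, k) (z - x, 0)]

end Calculus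

section Distribution

variable {n' n : ℕ} {Ω' : Set (Rn n')} {Ω : Set (Rn n)} {S : (Rn n → ℂ) →ₗ[ℂ] ℂ}

/-- The action of a functional in the second variable. -/
def slicePairing (S : (Rn n → ℂ) →ₗ[ℂ] ℂ) (w : Rn n' × Rn n → ℂ) : Rn n' → ℂ :=
  fun x => S fun y => w (x, y)

/-- The `k`-th partial derivative in the first variable. -/
def fstPartial (k : Fin n') (w : Rn n' × Rn n → ℂ) : Rn n' × Rn n → ℂ :=
  fun p => fderiv ℝ w p (EuclideanSpace.single k 1, 0)

theorem contDiffOn_fstPartial (hΩ' : IsOpen Ω') (hΩ : IsOpen Ω) {w : Rn n' × Rn n → ℂ}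
    (hw : ContDiffOn ℝ (⊤ : ℕ∞) w (Ω' ×ˢ Ω)) (k : Fin n') :
    ContDiffOn ℝ (⊤ : ℕ∞) (fstPartial k w) (Ω' ×ˢ Ω) :=
  contDiffOn_fderiv_apply (hΩ'.prod hΩ) hw _

theorem norm_iteratedFDeriv_fstPartial_le (hΩ' : IsOpen Ω') (hΩ : IsOpen Ω)
    {w : Rn n' × Rn n → ℂ} (hw : ContDiffOn ℝ (⊤ : ℕ∞) w (Ω' ×ˢ Ω)) (k : Fin n')
    {p : Rn n' × Rn n} (hp : p ∈ Ω' ×ˢ Ω) (i : ℕ) :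
    ‖iteratedFDeriv ℝ i (fstPartial k w) p‖ ≤ ‖iteratedFDeriv ℝ (i + 1) w p‖ := by
  exact (norm_iteratedFDeriv_fderiv_apply_le_s2 (hΩ'.prod hΩ) hw hp
    ((EuclideanSpace.single k 1, 0) : Rn n' × Rn n) i).trans_eq (by simp)

theorem fderiv_apply_eq_sum_fstPartial (w : Rn n' × Rn n → ℂ) (p : Rn n' × Rn n) (h : Rn n') :
    fderiv ℝ w p (h, 0) = ∑ k, (h k : ℂ) * fstPartial k w p := by
  have hh : ((h, 0) : Rn n' × Rn n)
      = ∑ k, h k • ((EuclideanSpace.single k 1, 0) : Rn n' × Rn n) := by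
    have h1 := (EuclideanSpace.basisFun (Fin n') ℝ).sum_repr h
    simp only [EuclideanSpace.basisFun_apply, EuclideanSpace.basisFun_repr] at h1
    ext1
    · rw [Prod.fst_sum]; simpa using h1.symm
    · rw [Prod.snd_sum]; simp
  rw [hh, map_sum]
  refine Finset.sum_congr rfl fun k _ => ?_
  rw [map_smul, Complex.real_smul, fstPartial]

/-- Differentiation under the action of a compactly supported distribution. -/
theorem hasFDerivAt_slicePairing (hΩ' : IsOpen Ω') (hΩ : IsOpen Ω)
    (hS : IsCptSuppDistributionOn Ω S) {w : Rn n' × Rn n → ℂ}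
    (hw : ContDiffOn ℝ (⊤ : ℕ∞) w (Ω' ×ˢ Ω)) {x : Rn n'} (hx : x ∈ Ω') :
    HasFDerivAt (slicePairing S w)
      (∑ k, (EuclideanSpace.proj k : Rn n' →L[ℝ] ℝ).smulRight
        (slicePairing S (fstPartial k w) x)) x := by
  obtain ⟨K, hK, hKΩ, j, C, hC, hSb⟩ := hS
  refine HasFDerivAt.of_isLittleO (Asymptotics.isLittleO_iff.2 fun c hc => ?_)
  have hc' : 0 < c / (C + 1) := by positivity
  have hall := (Filter.eventually_all_finset (Finset.range (j + 1))).2 fun i _ =>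
    eventually_norm_iteratedFDeriv_remainder_le hΩ' hΩ hK hKΩ hx i hw _ hc'
  filter_upwards [hall, hΩ'.mem_nhds hx] with z hz hzΩ
  have hR := hSb (fun y => w (z, y) - w (x, y) - fderiv ℝ w (x, y) (z - x, 0))
    (((contDiffOn_slice hw hzΩ).sub (contDiffOn_slice hw hx)).sub
      (contDiffOn_slice (contDiffOn_fderiv_apply (hΩ'.prod hΩ) hw (z - x, 0)) hx))
    (c / (C + 1) * ‖z - x‖)
    (fun y hy i hi => hz i (Finset.mem_range.2 (Nat.lt_succ_of_le hi)) y hy)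
  have heq : (fun y => w (z, y) - w (x, y) - fderiv ℝ w (x, y) (z - x, 0))
      = (fun y => w (z, y)) - (fun y => w (x, y))
        - ∑ k, ((z - x) k : ℂ) • fun y => fstPartial k w (x, y) := by
    funext y
    simp [fderiv_apply_eq_sum_fstPartial]
  rw [heq, map_sub, map_sub, map_sum] at hR
  simp only [map_smul, smul_eq_mul] at hR
  refine le_trans (le_of_eq ?_) (hR.trans ?_)
  · simp [slicePairing]
  · have h1 : C * (c / (C + 1)) ≤ c := by
      rw [mul_div_assoc', div_le_iff₀ (by positivity)]
      nlinarith
    calc C * (c / (C + 1) * ‖z - x‖) = C * (c / (C + 1)) * ‖z - x‖ := by ring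
      _ ≤ c * ‖z - x‖ := by gcongr

theorem contDiffOn_slicePairing (hΩ' : IsOpen Ω') (hΩ : IsOpen Ω)
    (hS : IsCptSuppDistributionOn Ω S) {w : Rn n' × Rn n → ℂ}
    (hw : ContDiffOn ℝ (⊤ : ℕ∞) w (Ω' ×ˢ Ω)) :
    ContDiffOn ℝ (⊤ : ℕ∞) (slicePairing S w) Ω' := by
  refine contDiffOn_infty.2 fun m => ?_
  induction m generalizing w with
  | zero =>
    exact contDiffOn_zero.2 fun x hx =>
      (hasFDerivAt_slicePairing hΩ' hΩ hS hw hx).continuousAt.continuousWithinAt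
  | succ m ih =>
    push_cast
    refine (contDiffOn_succ_iff_fderiv_of_isOpen hΩ').2 ⟨fun x hx =>
      (hasFDerivAt_slicePairing hΩ' hΩ hS hw hx).differentiableAt.differentiableWithinAt,
      fun h => absurd h (by simp), ?_⟩
    have hsum : ContDiffOn ℝ m (fun x => ∑ k, (EuclideanSpace.proj k : Rn n' →L[ℝ] ℝ).smulRight
        (slicePairing S (fstPartial k w) x)) Ω' :=
      ContDiffOn.sum fun k _ =>
        contDiffOn_const.smulRight (ih (contDiffOn_fstPartial hΩ' hΩ hw k))
    exact hsum.congr fun x hx => (hasFDerivAt_slicePairing hΩ' hΩ hS hw hx).fderiv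

theorem norm_iteratedFDeriv_succ_slicePairing_le (hΩ' : IsOpen Ω') (hΩ : IsOpen Ω)
    (hS : IsCptSuppDistributionOn Ω S) {w : Rn n' × Rn n → ℂ}
    (hw : ContDiffOn ℝ (⊤ : ℕ∞) w (Ω' ×ˢ Ω)) {x : Rn n'} (hx : x ∈ Ω') (i : ℕ) :
    ‖iteratedFDeriv ℝ (i + 1) (slicePairing S w) x‖
      ≤ ∑ k, ‖iteratedFDeriv ℝ i (slicePairing S (fstPartial k w)) x‖ := by
  let L : Fin n' → ℂ →L[ℝ] (Rn n' →L[ℝ] ℂ) := fun k =>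
    ContinuousLinearMap.smulRightL ℝ (Rn n') ℂ (EuclideanSpace.proj k)
  have hL : ∀ k, ‖L k‖ ≤ 1 := fun k => by
    refine ContinuousLinearMap.opNorm_le_bound _ zero_le_one fun a => ?_
    refine ContinuousLinearMap.opNorm_le_bound _ (by positivity) fun v => ?_
    have h1 : ‖v k‖ ≤ ‖v‖ := PiLp.norm_apply_le v k
    have h2 : ‖L k a v‖ = ‖v k‖ * ‖a‖ := by simp [L]
    rw [h2]
    nlinarith [norm_nonneg a]
  have hG : ∀ k, ContDiffAt ℝ (⊤ : ℕ∞) (slicePairing S (fstPartial k w)) x := fun k =>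
    (contDiffOn_slicePairing hΩ' hΩ hS (contDiffOn_fstPartial hΩ' hΩ hw k)).contDiffAt
      (hΩ'.mem_nhds hx)
  have hi : (i : WithTop ℕ∞) ≤ ((⊤ : ℕ∞) : WithTop ℕ∞) := by exact_mod_cast le_top
  have hev : fderiv ℝ (slicePairing S w) =ᶠ[𝓝 x]
      ∑ k, L k ∘ slicePairing S (fstPartial k w) := by
    filter_upwards [hΩ'.mem_nhds hx] with z hz
    rw [(hasFDerivAt_slicePairing hΩ' hΩ hS hw hz).fderiv, Finset.sum_apply]
    rfl
  rw [← norm_iteratedFDeriv_fderiv, (hev.iteratedFDeriv ℝ i).eq_of_nhds,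
    iteratedFDeriv_sum_apply fun k _ => ((L k).contDiff.contDiffAt.comp x (hG k)).of_le hi]
  refine (norm_sum_le _ _).trans (Finset.sum_le_sum fun k _ => ?_)
  refine ((L k).norm_iteratedFDeriv_comp_left (hG k) hi).trans ?_
  nlinarith [hL k, norm_nonneg (iteratedFDeriv ℝ i (slicePairing S (fstPartial k w)) x)]

theorem norm_iteratedFDeriv_slicePairing_le (hΩ' : IsOpen Ω') (hΩ : IsOpen Ω)
    (hS : IsCptSuppDistributionOn Ω S) {K : Set (Rn n)} (hKΩ : K ⊆ Ω) {j : ℕ} {A : ℝ}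
    (hSA : ∀ f : Rn n → ℂ, ContDiffOn ℝ (⊤ : ℕ∞) f Ω → ∀ C : ℝ, 0 ≤ C →
      (∀ y ∈ K, ∀ i ≤ j, ‖iteratedFDeriv ℝ i f y‖ ≤ C) → ‖S f‖ ≤ A * C)
    {x : Rn n'} (hx : x ∈ Ω') {B : ℝ} (hB : 0 ≤ B) (i : ℕ) {w : Rn n' × Rn n → ℂ}
    (hw : ContDiffOn ℝ (⊤ : ℕ∞) w (Ω' ×ˢ Ω))
    (hwB : ∀ y ∈ K, ∀ l ≤ i + j, ‖iteratedFDeriv ℝ l w (x, y)‖ ≤ B) :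
    ‖iteratedFDeriv ℝ i (slicePairing S w) x‖ ≤ (n' : ℝ) ^ i * (A * B) := by
  induction i generalizing w with
  | zero =>
    rw [norm_iteratedFDeriv_zero, pow_zero, one_mul]
    exact hSA _ (contDiffOn_slice hw hx) B hB fun y hy l hl =>
      (norm_iteratedFDeriv_slice_le hΩ' hΩ l hw hx (hKΩ hy)).trans (hwB y hy l (by omega))
  | succ i ih =>
    refine (norm_iteratedFDeriv_succ_slicePairing_le hΩ' hΩ hS hw hx i).trans ?_
    calc _ ≤ ∑ _k : Fin n', (n' : ℝ) ^ i * (A * B) := by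
          refine Finset.sum_le_sum fun k _ => ih (contDiffOn_fstPartial hΩ' hΩ hw k)
            fun y hy l hl => ?_
          exact (norm_iteratedFDeriv_fstPartial_le hΩ' hΩ hw k ⟨hx, hKΩ hy⟩ l).trans
            (hwB y hy (l + 1) (by omega))
      _ = (n' : ℝ) ^ (i + 1) * (A * B) := by simp; ring

theorem IsCptSuppDistributionOn.sub {S' : (Rn n → ℂ) →ₗ[ℂ] ℂ}
    (hS : IsCptSuppDistributionOn Ω S) (hS' : IsCptSuppDistributionOn Ω S') :
    IsCptSuppDistributionOn Ω (S - S') := by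
  obtain ⟨K, hK, hKΩ, j, C, hC, h⟩ := hS
  obtain ⟨K', hK', hKΩ', j', C', hC', h'⟩ := hS'
  refine ⟨K ∪ K', hK.union hK', union_subset hKΩ hKΩ', max j j', C + C', by positivity,
    fun f hf B hB => ?_⟩
  have h1 := h f hf B fun x hx i hi => hB x (Or.inl hx) i (hi.trans (le_max_left _ _))
  have h2 := h' f hf B fun x hx i hi => hB x (Or.inr hx) i (hi.trans (le_max_right _ _))
  calc ‖(S - S') f‖ ≤ ‖S f‖ + ‖S' f‖ := norm_sub_le _ _
    _ ≤ (C + C') * B := by linarith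

end Distribution

section Nets

theorem exists_Ioc_forall_iff_eventually {p : ℝ → Prop} :
    (∃ η ∈ Ioc (0:ℝ) 1, ∀ ε ∈ Ioc (0:ℝ) η, p ε) ↔ ∀ᶠ ε in 𝓝[>] (0:ℝ), p ε := by
  constructor
  · rintro ⟨η, hη, h⟩
    filter_upwards [Ioc_mem_nhdsGT hη.1] with ε hε using h ε hε
  · intro h
    obtain ⟨η, hη, h⟩ := mem_nhdsGT_iff_exists_Ioc_subset.1 h
    exact ⟨min η 1, ⟨lt_min hη one_pos, min_le_right _ _⟩,
      fun ε hε => h ⟨hε.1, hε.2.trans (min_le_left _ _)⟩⟩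

/-- Finitely many asymptotic bounds of the same rate hold with a common constant. -/
theorem exists_eventually_forall_le_mul {ι E : Type} [Finite ι] {f : ι → ℝ → E → ℝ} {K : Set E}
    {g : ℝ → ℝ} (hg : ∀ ε > 0, 0 ≤ g ε)
    (h : ∀ l, ∃ c > 0, ∀ᶠ ε in 𝓝[>] (0:ℝ), ∀ x ∈ K, f l ε x ≤ c * g ε) :
    ∃ c > 0, ∀ᶠ ε in 𝓝[>] (0:ℝ), ∀ x ∈ K, ∀ l, f l ε x ≤ c * g ε := by
  have := Fintype.ofFinite ι
  choose c hc hev using h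
  have hsum : 0 ≤ ∑ l, c l := Finset.sum_nonneg fun l _ => (hc l).le
  refine ⟨∑ l, c l + 1, by positivity, ?_⟩
  filter_upwards [Filter.eventually_all.2 hev, self_mem_nhdsWithin] with ε hε hpos x hx l
  refine (hε l x hx).trans (mul_le_mul_of_nonneg_right ?_ (hg ε hpos))
  have := Finset.single_le_sum (f := c) (fun l _ => (hc l).le) (Finset.mem_univ l)
  linarith

variable {n' n : ℕ} {Ω' : Set (Rn n')} {Ω : Set (Rn n)} {T : ℝ → (Rn n → ℂ) →ₗ[ℂ] ℂ}

theorem IsBasicNetE.contDiffOn_slicePairing (hΩ' : IsOpen Ω') (hΩ : IsOpen Ω)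
    (hT : IsBasicNetE Ω T) {w : ℝ → Rn n' × Rn n → ℂ}
    (hw : ∀ ε ∈ Ioc (0:ℝ) 1, ContDiffOn ℝ (⊤ : ℕ∞) (w ε) (Ω' ×ˢ Ω)) :
    ∀ ε ∈ Ioc (0:ℝ) 1, ContDiffOn ℝ (⊤ : ℕ∞) (slicePairing (T ε) (w ε)) Ω' :=
  fun ε hε => Colombeau.contDiffOn_slicePairing hΩ' hΩ (hT.1 ε hε) (hw ε hε)

/-- A basic net of functionals acting in the second variable loses only a fixed power of `ε`,
and only finitely many derivatives on a fixed compact set. -/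
theorem IsBasicNetE.exists_slicePairing_bound (hΩ' : IsOpen Ω') (hΩ : IsOpen Ω)
    (hT : IsBasicNetE Ω T) :
    ∃ K : Set (Rn n), IsCompact K ∧ K ⊆ Ω ∧ ∃ j N : ℕ, ∀ w : ℝ → Rn n' × Rn n → ℂ,
      (∀ ε ∈ Ioc (0:ℝ) 1, ContDiffOn ℝ (⊤ : ℕ∞) (w ε) (Ω' ×ˢ Ω)) →
      ∀ L ⊆ Ω', ∀ (i : ℕ) (r : ℝ),
        (∀ l ≤ i + j, ∃ c > 0, ∃ η ∈ Ioc (0:ℝ) 1, ∀ ε ∈ Ioc (0:ℝ) η, ∀ p ∈ L ×ˢ K,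
          ‖iteratedFDeriv ℝ l (w ε) p‖ ≤ c * ε ^ r) →
        ∃ c > 0, ∃ η ∈ Ioc (0:ℝ) 1, ∀ ε ∈ Ioc (0:ℝ) η, ∀ x ∈ L,
          ‖iteratedFDeriv ℝ i (slicePairing (T ε) (w ε)) x‖ ≤ c * ε ^ (r - N) := by
  obtain ⟨hT1, K, hK, hKΩ, j, N, hTb⟩ := hT
  rw [exists_Ioc_forall_iff_eventually] at hTb
  refine ⟨K, hK, hKΩ, j, N, fun w hw L hL i r h => ?_⟩
  obtain ⟨c, hc, hev⟩ := exists_eventually_forall_le_mul (ι := Fin (i + j + 1))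
    (f := fun l ε p => ‖iteratedFDeriv ℝ l (w ε) p‖) (g := fun ε => ε ^ r) (K := L ×ˢ K)
    (fun ε hε => Real.rpow_nonneg (le_of_lt hε) r) fun l => by
      simpa only [exists_Ioc_forall_iff_eventually] using h l (by omega)
  refine ⟨(n' : ℝ) ^ i * c + 1, by positivity, exists_Ioc_forall_iff_eventually.2 ?_⟩
  filter_upwards [hTb, hev, Ioc_mem_nhdsGT (zero_lt_one (α := ℝ))] with ε hTε hε hε1 x hx
  have hpos : 0 < ε := hε1.1
  refine (norm_iteratedFDeriv_slicePairing_le hΩ' hΩ (hT1 ε hε1) hKΩ hTε (hL hx)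
    (B := c * ε ^ r) (by positivity) i (hw ε hε1) fun y hy l hl =>
      hε (x, y) ⟨hx, hy⟩ ⟨l, by omega⟩).trans ?_
  have h1 : ε ^ (r - N) = ε ^ (-(N:ℝ)) * ε ^ r := by
    rw [← Real.rpow_add hpos]; ring_nf
  have h2 : 0 < ε ^ (r - N) := Real.rpow_pos_of_pos hpos _
  calc (n' : ℝ) ^ i * (ε ^ (-(N:ℝ)) * (c * ε ^ r)) = (n' : ℝ) ^ i * c * ε ^ (r - N) := by
        rw [h1]; ring
    _ ≤ ((n' : ℝ) ^ i * c + 1) * ε ^ (r - N) := by gcongr; linarith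

theorem IsBasicNetE.isModerate_slicePairing (hΩ' : IsOpen Ω') (hΩ : IsOpen Ω)
    (hT : IsBasicNetE Ω T) {w : ℝ → Rn n' × Rn n → ℂ} (hw : IsModerate (Ω' ×ˢ Ω) w) :
    IsModerate Ω' fun ε => slicePairing (T ε) (w ε) := by
  refine ⟨hT.contDiffOn_slicePairing hΩ' hΩ hw.1, fun L hL hLΩ i => ?_⟩
  obtain ⟨K, hK, hKΩ, j, N, hb⟩ := hT.exists_slicePairing_bound hΩ' hΩ
  choose M c hc η hη hM using hw.2 (L ×ˢ K) (hL.prod hK) (Set.prod_mono hLΩ hKΩ)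
  obtain ⟨M', hM'⟩ : ∃ M' : ℕ, ∀ l ≤ i + j, M l ≤ M' :=
    ⟨(Finset.range (i + j + 1)).sup M,
      fun l hl => Finset.le_sup (f := M) (Finset.mem_range.2 (Nat.lt_succ_of_le hl))⟩
  have hbound := hb w hw.1 L hLΩ i (-(M':ℝ)) fun l hl =>
    ⟨c l, hc l, η l, hη l, fun ε hε p hp => (hM l ε hε p hp).trans <|
      mul_le_mul_of_nonneg_left (Real.rpow_le_rpow_of_exponent_ge hε.1 (hε.2.trans (hη l).2)
        (neg_le_neg (by exact_mod_cast hM' l hl))) (hc l).le⟩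
  refine ⟨M' + N, ?_⟩
  rwa [show -(M':ℝ) - N = -((M' + N : ℕ):ℝ) by push_cast; ring] at hbound

theorem IsBasicNetE.isGinfModerate_slicePairing (hΩ' : IsOpen Ω') (hΩ : IsOpen Ω)
    (hT : IsBasicNetE Ω T) {w : ℝ → Rn n' × Rn n → ℂ} (hw : IsGinfModerate (Ω' ×ˢ Ω) w) :
    IsGinfModerate Ω' fun ε => slicePairing (T ε) (w ε) := by
  refine ⟨hT.contDiffOn_slicePairing hΩ' hΩ hw.1, fun L hL hLΩ => ?_⟩
  obtain ⟨K, hK, hKΩ, j, N, hb⟩ := hT.exists_slicePairing_bound hΩ' hΩ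
  obtain ⟨M, hM⟩ := hw.2 (L ×ˢ K) (hL.prod hK) (Set.prod_mono hLΩ hKΩ)
  refine ⟨M + N, fun i => ?_⟩
  have hbound := hb w hw.1 L hLΩ i (-(M:ℝ)) fun l _ => hM l
  rwa [show -(M:ℝ) - N = -((M + N : ℕ):ℝ) by push_cast; ring] at hbound

theorem IsBasicNetE.isNegligible_slicePairing (hΩ' : IsOpen Ω') (hΩ : IsOpen Ω)
    (hT : IsBasicNetE Ω T) {w : ℝ → Rn n' × Rn n → ℂ} (hw : IsNegligible (Ω' ×ˢ Ω) w) :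
    IsNegligible Ω' fun ε => slicePairing (T ε) (w ε) := by
  refine ⟨hT.contDiffOn_slicePairing hΩ' hΩ hw.1, fun L hL hLΩ i q => ?_⟩
  obtain ⟨K, hK, hKΩ, j, N, hb⟩ := hT.exists_slicePairing_bound hΩ' hΩ
  have hbound := hb w hw.1 L hLΩ i ((q + N : ℕ):ℝ) fun l _ =>
    hw.2 (L ×ˢ K) (hL.prod hK) (Set.prod_mono hLΩ hKΩ) l (q + N)
  rwa [show ((q + N : ℕ):ℝ) - N = (q:ℝ) by push_cast; ring] at hbound

theorem IsModerate.fstPartial (hΩ' : IsOpen Ω') (hΩ : IsOpen Ω) {w : ℝ → Rn n' × Rn n → ℂ}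
    (hw : IsModerate (Ω' ×ˢ Ω) w) (k : Fin n') :
    IsModerate (Ω' ×ˢ Ω) fun ε => Colombeau.fstPartial k (w ε) := by
  refine ⟨fun ε hε => contDiffOn_fstPartial hΩ' hΩ (hw.1 ε hε) k, fun K hK hKΩ i => ?_⟩
  obtain ⟨N, c, hc, η, hη, h⟩ := hw.2 K hK hKΩ (i + 1)
  exact ⟨N, c, hc, η, hη, fun ε hε p hp => (norm_iteratedFDeriv_fstPartial_le hΩ' hΩ
    (hw.1 ε ⟨hε.1, hε.2.trans hη.2⟩) k (hKΩ hp) i).trans (h ε hε p hp)⟩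

/-- Evaluating the first variable along a net of points in a compact set preserves
moderateness. -/
theorem IsModerate.slice (hΩ' : IsOpen Ω') (hΩ : IsOpen Ω) {w : ℝ → Rn n' × Rn n → ℂ}
    (hw : IsModerate (Ω' ×ˢ Ω) w) {L : Set (Rn n')} (hL : IsCompact L) (hLΩ : L ⊆ Ω')
    {a : ℝ → Rn n'} (ha : ∀ ε ∈ Ioc (0:ℝ) 1, a ε ∈ L) :
    IsModerate Ω fun ε y => w ε (a ε, y) := by
  refine ⟨fun ε hε => contDiffOn_slice (hw.1 ε hε) (hLΩ (ha ε hε)), fun K hK hKΩ i => ?_⟩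
  obtain ⟨N, c, hc, η, hη, h⟩ := hw.2 (L ×ˢ K) (hL.prod hK) (Set.prod_mono hLΩ hKΩ) i
  refine ⟨N, c, hc, η, hη, fun ε hε y hy => ?_⟩
  have hε1 : ε ∈ Ioc (0:ℝ) 1 := ⟨hε.1, hε.2.trans hη.2⟩
  exact (norm_iteratedFDeriv_slice_le hΩ' hΩ i (hw.1 ε hε1) (hLΩ (ha ε hε1)) (hKΩ hy)).trans
    (h ε hε _ ⟨ha ε hε1, hy⟩)

/-- A net of compactly supported distributions that maps moderate nets to negligible numbers
maps moderate nets with parameters to negligible nets. -/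
theorem isNegligible_slicePairing_of_forall_cIsNegligible (hΩ' : IsOpen Ω') (hΩ : IsOpen Ω)
    (hT : ∀ ε ∈ Ioc (0:ℝ) 1, IsCptSuppDistributionOn Ω (T ε))
    (hneg : ∀ v : ℝ → Rn n → ℂ, IsModerate Ω v → CIsNegligible fun ε => T ε (v ε))
    {w : ℝ → Rn n' × Rn n → ℂ} (hw : IsModerate (Ω' ×ˢ Ω) w) :
    IsNegligible Ω' fun ε => slicePairing (T ε) (w ε) := by
  refine ⟨fun ε hε => contDiffOn_slicePairing hΩ' hΩ (hT ε hε) (hw.1 ε hε),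
    fun L hL hLΩ i q => ?_⟩
  induction i generalizing w with
  | zero =>
    rcases L.eq_empty_or_nonempty with rfl | hne
    · exact ⟨1, one_pos, 1, ⟨one_pos, le_rfl⟩, by simp⟩
    have hmax : ∀ ε, ∃ a, ε ∈ Ioc (0:ℝ) 1 →
        a ∈ L ∧ ∀ x ∈ L, ‖slicePairing (T ε) (w ε) x‖ ≤ ‖slicePairing (T ε) (w ε) a‖ := by
      intro ε
      by_cases hε : ε ∈ Ioc (0:ℝ) 1
      · obtain ⟨a, ha, hmax⟩ := hL.exists_isMaxOn hne
          ((contDiffOn_slicePairing hΩ' hΩ (hT ε hε) (hw.1 ε hε)).continuousOn.mono hLΩ).norm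
        exact ⟨a, fun _ => ⟨ha, hmax⟩⟩
      · exact ⟨0, fun h => absurd h hε⟩
    choose a ha using hmax
    obtain ⟨c, hc, η, hη, h⟩ := hneg _ (hw.slice hΩ' hΩ hL hLΩ fun ε hε => (ha ε hε).1) q
    refine ⟨c, hc, η, hη, fun ε hε x hx => ?_⟩
    rw [norm_iteratedFDeriv_zero]
    exact ((ha ε ⟨hε.1, hε.2.trans hη.2⟩).2 x hx).trans (h ε hε)
  | succ i ih =>
    obtain ⟨c, hc, hev⟩ := exists_eventually_forall_le_mul (K := L) (ι := Fin n')
      (f := fun k ε x => ‖iteratedFDeriv ℝ i (slicePairing (T ε) (fstPartial k (w ε))) x‖)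
      (g := fun ε => ε ^ (q:ℝ)) (fun ε hε => Real.rpow_nonneg (le_of_lt hε) _) fun k => by
        simpa only [exists_Ioc_forall_iff_eventually] using ih (hw.fstPartial hΩ' hΩ k)
    refine ⟨n' * c + 1, by positivity, exists_Ioc_forall_iff_eventually.2 ?_⟩
    filter_upwards [hev, Ioc_mem_nhdsGT (zero_lt_one (α := ℝ))] with ε hε hε1 x hx
    have hpos : 0 < ε ^ (q:ℝ) := Real.rpow_pos_of_pos hε1.1 _
    calc _ ≤ ∑ k, ‖iteratedFDeriv ℝ i (slicePairing (T ε) (fstPartial k (w ε))) x‖ :=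
          norm_iteratedFDeriv_succ_slicePairing_le hΩ' hΩ (hT ε hε1) (hw.1 ε hε1) (hLΩ hx) i
      _ ≤ ∑ _k : Fin n', c * ε ^ (q:ℝ) := Finset.sum_le_sum fun k _ => hε x hx k
      _ = n' * c * ε ^ (q:ℝ) := by simp; ring
      _ ≤ (n' * c + 1) * ε ^ (q:ℝ) := by gcongr; linarith

end Nets

end Colombeau

/-- Let `Ω' ⊆ ℝ^{n'}` and `Ω ⊆ ℝ^n` be open and let `T` be a basic
functional in `L(G(Ω),ℂ̃)`, defined by a net `(T_ε)` of compactly supported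
distributions.  If `u ∈ G(Ω'×Ω)` then `T(u(x,·)) := [(T_ε(u_ε(x,·)))_ε]` is a
well-defined element of `G(Ω')`; if moreover `u ∈ G^∞(Ω'×Ω)` then
`T(u(x,·)) ∈ G^∞(Ω')`. -/
theorem statement2
    {n' n : ℕ} (Ω' : Set (Rn n')) (Ω : Set (Rn n))
    (hΩ' : IsOpen Ω') (hΩ : IsOpen Ω)
    (T : ℝ → (Rn n → ℂ) →ₗ[ℂ] ℂ) (hT : IsBasicNetE Ω T)
    (u : ℝ → (Rn n' × Rn n) → ℂ)
    (hu : IsModerate (Ω' ×ˢ Ω) u) :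
    -- `T(u(x,·))` is a moderate net of smooth functions on `Ω'`
    IsModerate Ω' (fun ε x => T ε (fun y => u ε (x, y))) ∧
    -- independence of the representative of `u`
    (∀ u' : ℝ → (Rn n' × Rn n) → ℂ, IsModerate (Ω' ×ˢ Ω) u' →
      IsNegligible (Ω' ×ˢ Ω) (fun ε p => u ε p - u' ε p) →
      IsNegligible Ω' (fun ε x => T ε (fun y => u ε (x, y)) - T ε (fun y => u' ε (x, y)))) ∧
    -- independence of the net defining `T`
    (∀ T' : ℝ → (Rn n → ℂ) →ₗ[ℂ] ℂ, IsBasicNetE Ω T' →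
      (∀ v : ℝ → Rn n → ℂ, IsModerate Ω v →
        CIsNegligible (fun ε => T ε (v ε) - T' ε (v ε))) →
      IsNegligible Ω' (fun ε x => T ε (fun y => u ε (x, y)) - T' ε (fun y => u ε (x, y)))) ∧
    -- the `G^∞` case
    (IsGinfModerate (Ω' ×ˢ Ω) u →
      IsGinfModerate Ω' (fun ε x => T ε (fun y => u ε (x, y)))) := by
  refine ⟨hT.isModerate_slicePairing hΩ' hΩ hu, fun u' _ hneg => ?_, fun T' hT' hneg => ?_,
    fun hu' => hT.isGinfModerate_slicePairing hΩ' hΩ hu'⟩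
  · simp only [← map_sub]
    exact hT.isNegligible_slicePairing hΩ' hΩ hneg
  · exact isNegligible_slicePairing_of_forall_cIsNegligible (T := fun ε => T ε - T' ε) hΩ' hΩ
      (fun ε hε => (hT.1 ε hε).sub (hT'.1 ε hε)) hneg hu
end
end
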